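/- arXiv:2206.13308 — 2 statements merged into one kernel-verified Lean document; each statement's English description precedes it below -/
import Mathlib

section
/- Let n ≥ 4. Then the Artin group A(D_n) is isomorphic to the quotient of the Artin group A(Δ_n) (on generators a_1, …, a_n) by the normal closure of the cycle commutator cc(a_1, a_2, …, a_n). -/
/- Scaffolding: braid/commuting predicates, ordered products, cycle and twisted
cycle commutators, and the Artin groups of the diagrams `Δ_n`, `Δ_{t,n}`, `D_n`
(generators numbered `1, …, n` as in the paper, realized on the index type `Fin n`). -/

namespace ArtinPaper

open scoped commutatorElement

/-- `BR u v` : `u` and `v` braid, i.e. `u v u = v u v`. -/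
def BR {G : Type*} [Group G] (u v : G) : Prop := u * v * u = v * u * v

/-- `CM u v` : `u` and `v` commute, i.e. `u v = v u`. -/
def CM {G : Type*} [Group G] (u v : G) : Prop := u * v = v * u

/-- `mulIcc y a b = y a * y (a+1) * ⋯ * y b` (equal to `1` when `a > b`). -/
def mulIcc {M : Type*} [Monoid M] (y : ℕ → M) (a b : ℕ) : M :=
  ((List.range (b + 1 - a)).map fun i => y (a + i)).prod

/-- The cycle commutator
`cc(y₁,…,yₙ) = [y₁, y₂ ⋯ y_{n-1} yₙ y_{n-1}⁻¹ ⋯ y₂⁻¹]`. -/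
def cc {G : Type*} [Group G] (y : ℕ → G) (n : ℕ) : G :=
  ⁅y 1, mulIcc y 2 (n - 1) * y n * (mulIcc y 2 (n - 1))⁻¹⁆

/-- The `t`-twisted cycle commutator
`tc_t(y₁,…,yₙ) = [y₁, y₂⁻¹ ⋯ y_{t+1}⁻¹ y_{t+2} ⋯ y_{n-1} yₙ y_{n-1}⁻¹ ⋯ y_{t+2}⁻¹ y_{t+1} ⋯ y₂]`.
(The twisted cycle commutator `tc(y₁,y₂,y₃,y₄)` is `tc y 4 1`.) -/
def tc {G : Type*} [Group G] (y : ℕ → G) (n t : ℕ) : G :=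
  ⁅y 1, mulIcc (fun i => (y i)⁻¹) 2 (t + 1) *
      (mulIcc y (t + 2) (n - 1) * y n * (mulIcc y (t + 2) (n - 1))⁻¹) *
      (mulIcc (fun i => (y i)⁻¹) 2 (t + 1))⁻¹⁆

/-- The `i`-th generator (numbered `1, …, n`) of the free group on `Fin n`. -/
def gen (n i : ℕ) : FreeGroup (Fin n) :=
  if h : 0 < n then FreeGroup.of ⟨(i - 1) % n, Nat.mod_lt _ h⟩ else 1

/-- The braid relator `u v u (v u v)⁻¹`. -/
def braidRel {G : Type*} [Group G] (u v : G) : G := u * v * u * (v * u * v)⁻¹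

/-- Artin-type relations on generators `1, …, n` determined by an edge predicate `E`:
generators joined by an edge braid, all other pairs of generators commute. -/
def relsOf (n : ℕ) (E : ℕ → ℕ → Prop) : Set (FreeGroup (Fin n)) :=
  { w | ∃ i j, 1 ≤ i ∧ i < j ∧ j ≤ n ∧
      ((E i j ∧ w = braidRel (gen n i) (gen n j)) ∨
       (¬ E i j ∧ w = ⁅gen n i, gen n j⁆)) }

/-- Edges of the `n`-cycle `Δ_n`: `{i, i+1}` for `1 ≤ i ≤ n-1`, and `{1, n}`. -/
def cycEdge (n i j : ℕ) : Prop := (1 ≤ i ∧ i + 1 ≤ n ∧ j = i + 1) ∨ (i = 1 ∧ j = n)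

/-- Defining relations of the Artin group `A(Δ_n)` of the `n`-cycle. -/
def cycleRels (n : ℕ) : Set (FreeGroup (Fin n)) := relsOf n (cycEdge n)

/-- Edges of the diagram `Δ_{t,n}`, where `r = n - 3 - t` and the generators are
`b_1, …, b_{4+r}` (vertices `1, …, 4+r`) and `c_{5+r}, …, c_n` (vertices `5+r, …, n`):
the braiding pairs are `{b_1,b_2}, {b_2,b_3}, {b_3,b_1}, {b_4,b_1}, {b_1,b_5}`,
`{b_i,b_{i+1}}` for `5 ≤ i ≤ 3+r`, `{b_3,c_{5+r}}`, and `{c_i,c_{i+1}}` for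
`5+r ≤ i ≤ n-1`. -/
def deltaEdge (n t i j : ℕ) : Prop :=
  (i = 1 ∧ j = 2) ∨ (i = 2 ∧ j = 3) ∨ (i = 1 ∧ j = 3) ∨ (i = 1 ∧ j = 4) ∨
  (i = 1 ∧ j = 5 ∧ 5 ≤ 4 + (n - 3 - t)) ∨
  (5 ≤ i ∧ i + 1 ≤ 4 + (n - 3 - t) ∧ j = i + 1) ∨
  (i = 3 ∧ j = 5 + (n - 3 - t) ∧ 5 + (n - 3 - t) ≤ n) ∨
  (5 + (n - 3 - t) ≤ i ∧ i + 1 ≤ n ∧ j = i + 1)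

/-- Defining relations of the Artin group `A(Δ_{t,n})`. -/
def deltaRels (n t : ℕ) : Set (FreeGroup (Fin n)) := relsOf n (deltaEdge n t)

/-- Edges of the Coxeter diagram `D_n`: `{1,3}, {2,3}`, and `{i, i+1}` for
`3 ≤ i ≤ n-1` (in particular `1` and `2` are not joined, so `x_1 x_2 = x_2 x_1`). -/
def dEdge (n i j : ℕ) : Prop :=
  (i = 1 ∧ j = 3) ∨ (i = 2 ∧ j = 3) ∨ (3 ≤ i ∧ i + 1 ≤ n ∧ j = i + 1)

/-- Defining relations of the Artin group `A(D_n)` of type `D_n`. -/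
def dRels (n : ℕ) : Set (FreeGroup (Fin n)) := relsOf n (dEdge n)

/-- The Artin group `A(D_n)` of type `D_n`. -/
abbrev ArtinD (n : ℕ) := PresentedGroup (dRels n)

/-- `G_{n,t}`: the quotient of `A(Δ_n)` by the normal closure of the `t`-twisted
cycle commutator `tc_t(a_1, …, a_n)`. -/
abbrev Gnt (n t : ℕ) := PresentedGroup (cycleRels n ∪ {tc (gen n) n t})

/-- `Q_{n,t}`: the quotient of `A(Δ_{t,n})` by the normal closure of the twisted
cycle commutator `tc(b_1, b_2, b_3, b_4)`. -/
abbrev Qnt (n t : ℕ) := PresentedGroup (deltaRels n t ∪ {tc (gen n) 4 1})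

section Band

variable {G : Type*} [Group G]

theorem BR.symm {u v : G} (h : BR u v) : BR v u := Eq.symm h

theorem BR.map {H : Type*} [Group H] (f : G →* H) {u v : G} (h : BR u v) : BR (f u) (f v) := by
  simpa [BR] using congrArg f h

theorem BR.conj (g : G) {u v : G} (h : BR u v) : BR (g * u * g⁻¹) (g * v * g⁻¹) := by
  simpa using h.map (MulAut.conj g).toMonoidHom

theorem BR.conj' (g : G) {u v : G} (h : BR u v) : BR (g⁻¹ * u * g) (g⁻¹ * v * g) := by
  simpa using h.conj g⁻¹

theorem BR.semiconjBy {u v : G} (h : BR u v) : SemiconjBy (u * v) u v := by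
  simpa [SemiconjBy, BR, mul_assoc] using h

theorem BR.inv_mul_mul {u v : G} (h : BR u v) : v⁻¹ * u * v = u * v * u⁻¹ := by
  rw [eq_mul_inv_iff_mul_eq, mul_assoc, mul_assoc, inv_mul_eq_iff_eq_mul]
  simpa [BR, mul_assoc] using h

theorem _root_.Commute.mul_mul_inv_eq {u v : G} (h : Commute u v) : u * v * u⁻¹ = v := by
  rw [h.eq, mul_inv_cancel_right]

theorem _root_.Commute.inv_mul_mul_eq {u v : G} (h : Commute u v) : u⁻¹ * v * u = v := by
  rw [mul_assoc, ← h.eq, inv_mul_cancel_left]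

theorem _root_.SemiconjBy.mul_mul_inv_eq {g u v : G} (h : SemiconjBy g u v) :
    g * u * g⁻¹ = v := by
  rw [h.eq, mul_inv_cancel_right]

theorem mulIcc_of_lt {M : Type*} [Monoid M] (y : ℕ → M) {a b : ℕ} (h : b < a) :
    mulIcc y a b = 1 := by
  simp [mulIcc, Nat.sub_eq_zero_of_le (Nat.succ_le_of_lt h)]

theorem mulIcc_succ_right {M : Type*} [Monoid M] (y : ℕ → M) {a b : ℕ} (h : a ≤ b + 1) :
    mulIcc y a (b + 1) = mulIcc y a b * y (b + 1) := by
  have e : b + 1 + 1 - a = (b + 1 - a) + 1 := by omega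
  have e' : a + (b + 1 - a) = b + 1 := by omega
  simp [mulIcc, e, List.range_succ, e']

theorem mulIcc_eq_mul {M : Type*} [Monoid M] (y : ℕ → M) {a b : ℕ} (h : a ≤ b) :
    mulIcc y a b = y a * mulIcc y (a + 1) b := by
  have e : b + 1 - a = (b + 1 - (a + 1)) + 1 := by omega
  rw [mulIcc, mulIcc, e, List.range_succ_eq_map]
  simp [Function.comp_def, Nat.add_comm, Nat.add_left_comm]

theorem mulIcc_shift {M : Type*} [Monoid M] (y : ℕ → M) (a b : ℕ) :
    mulIcc (fun i => y (i + 1)) a b = mulIcc y (a + 1) (b + 1) := by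
  simp [mulIcc, Nat.add_right_comm]

theorem mulIcc_congr {M : Type*} [Monoid M] {y z : ℕ → M} {a b : ℕ}
    (h : ∀ i, a ≤ i → i ≤ b → y i = z i) : mulIcc y a b = mulIcc z a b := by
  unfold mulIcc
  congr 1
  refine List.map_congr_left fun i hi => h _ (by omega) ?_
  have := List.mem_range.1 hi
  omega

theorem map_mulIcc {M N : Type*} [Monoid M] [Monoid N] (f : M →* N) (y : ℕ → M) (a b : ℕ) :
    f (mulIcc y a b) = mulIcc (fun i => f (y i)) a b := by
  simp [mulIcc, map_list_prod, Function.comp_def]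

theorem map_cc {H : Type*} [Group H] (f : G →* H) (y : ℕ → G) (n : ℕ) :
    f (cc y n) = cc (fun i => f (y i)) n := by
  simp [cc, map_commutatorElement, map_mulIcc]

theorem semiconjBy_mulIcc {y z : ℕ → G} {g : G} {a b : ℕ}
    (h : ∀ i, a ≤ i → i ≤ b → SemiconjBy g (y i) (z i)) :
    SemiconjBy g (mulIcc y a b) (mulIcc z a b) := by
  rw [SemiconjBy, ← mul_inv_eq_iff_eq_mul]
  have := map_mulIcc (MulAut.conj g).toMonoidHom y a b
  exact this.trans (mulIcc_congr fun i h₁ h₂ => (h i h₁ h₂).mul_mul_inv_eq)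

theorem commute_mulIcc {y : ℕ → G} {g : G} {a b : ℕ}
    (h : ∀ i, a ≤ i → i ≤ b → Commute g (y i)) : Commute g (mulIcc y a b) :=
  semiconjBy_mulIcc h

/-- The elements `y a, …, y b` satisfy the Artin relations of a linear diagram. -/
structure IsLine (y : ℕ → G) (a b : ℕ) : Prop where
  br : ∀ i, a ≤ i → i < b → BR (y i) (y (i + 1))
  comm : ∀ i j, a ≤ i → i + 1 < j → j ≤ b → Commute (y i) (y j)

theorem IsLine.mono {y : ℕ → G} {a b c d : ℕ} (h : IsLine y a b) (hac : a ≤ c) (hdb : d ≤ b) :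
    IsLine y c d :=
  ⟨fun i h₁ h₂ => h.br i (by omega) (by omega),
    fun i j h₁ h₂ h₃ => h.comm i j (by omega) h₂ (by omega)⟩

theorem IsLine.semiconjBy {y : ℕ → G} {a b : ℕ} (h : IsLine y a b) {i : ℕ} (hi : a ≤ i)
    (hib : i < b) : SemiconjBy (mulIcc y a b) (y i) (y (i + 1)) := by
  induction b, hib using Nat.le_induction with
  | base =>
    obtain _ | i := i
    · rw [mulIcc_succ_right y (by omega), Nat.le_zero.1 hi, mulIcc_eq_mul y le_rfl,
        mulIcc_of_lt y (by omega), mul_one]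
      exact (h.br 0 (by omega) (by omega)).semiconjBy
    · rw [mulIcc_succ_right y (by omega), mulIcc_succ_right y (by omega), mul_assoc]
      refine SemiconjBy.mul_left ?_ (h.br (i + 1) hi (by omega)).semiconjBy
      exact (commute_mulIcc fun j h₁ h₂ => (h.comm j _ h₁ (by omega) le_rfl).symm).symm
  | succ b hb ih =>
    rw [mulIcc_succ_right y (by omega)]
    exact (ih (h.mono le_rfl (by omega))).mul_left
      (h.comm i _ hi (by omega) le_rfl).symm

/-- The two descriptions of the band generator of a line. -/
theorem IsLine.conj_eq {y : ℕ → G} {a b : ℕ} (h : IsLine y a (b + 1)) (hab : a ≤ b + 1) :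
    mulIcc y a b * y (b + 1) * (mulIcc y a b)⁻¹ =
      (mulIcc y (a + 1) (b + 1))⁻¹ * y a * mulIcc y (a + 1) (b + 1) := by
  have key : SemiconjBy (mulIcc y a (b + 1)) (mulIcc y a b) (mulIcc y (a + 1) (b + 1)) := by
    rw [← mulIcc_shift]
    exact semiconjBy_mulIcc fun i h₁ h₂ => h.semiconjBy h₁ (by omega)
  rw [← mulIcc_succ_right y hab, mul_assoc, ← mulIcc_eq_mul y hab, mul_inv_eq_iff_eq_mul,
    mul_assoc, eq_inv_mul_iff_mul_eq]
  exact key.eq.symm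

theorem IsLine.commute_band {y : ℕ → G} {a b : ℕ} (h : IsLine y a (b + 1)) {i : ℕ} (hi : a < i)
    (hib : i ≤ b) : Commute (mulIcc y a b * y (b + 1) * (mulIcc y a b)⁻¹) (y i) := by
  obtain _ | i := i
  · omega
  rw [← ((h.mono le_rfl (Nat.le_succ b)).semiconjBy (Nat.lt_succ_iff.1 hi) hib).mul_mul_inv_eq]
  exact (Commute.conj_iff _).2 (h.comm i _ (by omega) (by omega) le_rfl).symm

theorem IsLine.br_band_left {y : ℕ → G} {a b : ℕ} (h : IsLine y a (b + 1)) (hab : a ≤ b) :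
    BR (mulIcc y a b * y (b + 1) * (mulIcc y a b)⁻¹) (y a) := by
  have e : mulIcc y a b * y (b + 1) * (mulIcc y a b)⁻¹ =
      y a * (mulIcc y (a + 1) b * y (b + 1) * (mulIcc y (a + 1) b)⁻¹) * (y a)⁻¹ := by
    rw [mulIcc_eq_mul y hab]; group
  have e' : BR ((mulIcc y (a + 1 + 1) (b + 1))⁻¹ * y (a + 1) * mulIcc y (a + 1 + 1) (b + 1))
      (y a) := by
    have := (h.br a le_rfl (by omega)).symm.conj' (mulIcc y (a + 1 + 1) (b + 1))
    rwa [Commute.inv_mul_mul_eq (u := mulIcc y (a + 1 + 1) (b + 1)) (v := y a)] at this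
    exact (commute_mulIcc fun j h₁ h₂ => h.comm a j le_rfl (by omega) h₂).symm
  rw [e, (h.mono (Nat.le_succ a) le_rfl).conj_eq (by omega)]
  simpa using e'.conj (y a)

theorem IsLine.br_band_right {y : ℕ → G} {a b : ℕ} (h : IsLine y a (b + 1)) (hab : a ≤ b) :
    BR (mulIcc y a b * y (b + 1) * (mulIcc y a b)⁻¹) (y (b + 1)) := by
  have e : mulIcc y a b * y (b + 1) * (mulIcc y a b)⁻¹ =
      (y (b + 1))⁻¹ * ((mulIcc y (a + 1) b)⁻¹ * y a * mulIcc y (a + 1) b) * y (b + 1) := by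
    rw [h.conj_eq (by omega), mulIcc_succ_right y (by omega)]; group
  have e' : BR ((mulIcc y (a + 1) b)⁻¹ * y a * mulIcc y (a + 1) b) (y (b + 1)) := by
    obtain rfl | hlt := hab.eq_or_lt
    · simpa [mulIcc_of_lt y (Nat.lt_succ_self a)] using h.br a le_rfl (by omega)
    · obtain _ | b := b
      · omega
      rw [← (h.mono le_rfl (Nat.le_succ _)).conj_eq hab]
      have := (h.br (b + 1) hab (by omega)).conj (mulIcc y a b)
      rwa [Commute.mul_mul_inv_eq (u := mulIcc y a b) (v := y (b + 1 + 1))] at this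
      exact (commute_mulIcc fun j h₁ h₂ => (h.comm j _ h₁ (by omega) le_rfl).symm).symm
  rw [e]
  simpa using e'.conj' (y (b + 1))

end Band

section Presentation

variable {G : Type*} [Group G]

theorem braidRel_eq_one_iff {u v : G} : braidRel u v = 1 ↔ BR u v := mul_inv_eq_one

/-- The elements `y 1, …, y n` satisfy the Artin relations given by `E`. -/
structure ArtinRels (n : ℕ) (E : ℕ → ℕ → Prop) (y : ℕ → G) : Prop where
  br : ∀ i j, 1 ≤ i → i < j → j ≤ n → E i j → BR (y i) (y j)
  comm : ∀ i j, 1 ≤ i → i < j → j ≤ n → ¬ E i j → Commute (y i) (y j)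

theorem lift_gen {n i : ℕ} (y : ℕ → G) (h₁ : 1 ≤ i) (h₂ : i ≤ n) :
    FreeGroup.lift (fun k : Fin n => y (k + 1)) (gen n i) = y i := by
  have h : 0 < n := by omega
  have e : (i - 1) % n + 1 = i := by rw [Nat.mod_eq_of_lt (by omega)]; omega
  simp [gen, h, e]

theorem ArtinRels.lift_eq_one {n : ℕ} {E : ℕ → ℕ → Prop} {y : ℕ → G} (h : ArtinRels n E y)
    {r : FreeGroup (Fin n)} (hr : r ∈ relsOf n E) :
    FreeGroup.lift (fun k : Fin n => y (k + 1)) r = 1 := by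
  obtain ⟨i, j, hi, hij, hj, ⟨hE, rfl⟩ | ⟨hE, rfl⟩⟩ := hr
  · have := h.br i j hi hij hj hE
    rw [← lift_gen (n := n) y hi (by omega), ← lift_gen (n := n) y (by omega) hj] at this
    rw [← braidRel_eq_one_iff] at this
    simpa [braidRel] using this
  · rw [map_commutatorElement, lift_gen y hi (by omega), lift_gen y (by omega) hj,
      commutatorElement_eq_one_iff_commute]
    exact h.comm i j hi hij hj hE

theorem artinRels_of_map {n : ℕ} {E : ℕ → ℕ → Prop} (f : FreeGroup (Fin n) →* G)
    (h : ∀ r ∈ relsOf n E, f r = 1) : ArtinRels n E fun i => f (gen n i) where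
  br i j hi hij hj hE := by
    rw [← braidRel_eq_one_iff]
    simpa [braidRel] using h _ ⟨i, j, hi, hij, hj, .inl ⟨hE, rfl⟩⟩
  comm i j hi hij hj hE := by
    rw [← commutatorElement_eq_one_iff_commute, ← map_commutatorElement]
    exact h _ ⟨i, j, hi, hij, hj, .inr ⟨hE, rfl⟩⟩

theorem hom_ext_gen {n : ℕ} {rels : Set (FreeGroup (Fin n))} {f g : PresentedGroup rels →* G}
    (h : ∀ i, 1 ≤ i → i ≤ n →
      f (PresentedGroup.mk rels (gen n i)) = g (PresentedGroup.mk rels (gen n i))) : f = g := by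
  refine PresentedGroup.ext fun k => ?_
  have hk : gen n (k + 1) = FreeGroup.of k := by
    have : 0 < n := by have := k.2; omega
    simp [gen, this, Nat.mod_eq_of_lt k.2]
  have := h (k + 1) (by omega) (by have := k.2; omega)
  rwa [hk] at this

theorem lift_mk_gen {n i : ℕ} {rels : Set (FreeGroup (Fin n))} {y : ℕ → G}
    (h : ∀ r ∈ rels, FreeGroup.lift (fun k : Fin n => y (k + 1)) r = 1) (h₁ : 1 ≤ i)
    (h₂ : i ≤ n) : PresentedGroup.toGroup h (PresentedGroup.mk rels (gen n i)) = y i :=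
  lift_gen y h₁ h₂

/-- The images in `A(Δ_n)` modulo the cycle commutator of the generators of `A(D_n)`. -/
def dOfCycle (n : ℕ) (y : ℕ → G) (i : ℕ) : G :=
  if i = 1 then y 1 else
  if i = 2 then mulIcc y 2 (n - 1) * y n * (mulIcc y 2 (n - 1))⁻¹ else y (i - 1)

/-- The images in `A(D_n)` of the generators of `A(Δ_n)`. -/
def cycleOfD (n : ℕ) (x : ℕ → G) (i : ℕ) : G :=
  if i = 1 then x 1 else
  if i = n then (mulIcc x 3 n)⁻¹ * x 2 * mulIcc x 3 n else x (i + 1)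

theorem mulIcc_cycleOfD {n : ℕ} (hn : 1 ≤ n) (x : ℕ → G) :
    mulIcc (cycleOfD n x) 2 (n - 1) = mulIcc x 3 n := by
  obtain ⟨n, rfl⟩ := Nat.exists_eq_add_of_le' hn
  rw [← mulIcc_shift, Nat.add_sub_cancel]
  refine mulIcc_congr fun i h₁ h₂ => ?_
  rw [cycleOfD, if_neg (by omega), if_neg (by omega)]

theorem mulIcc_dOfCycle {n : ℕ} (hn : 1 ≤ n) (y : ℕ → G) :
    mulIcc (dOfCycle n y) 3 n = mulIcc y 2 (n - 1) := by
  obtain ⟨n, rfl⟩ := Nat.exists_eq_add_of_le' hn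
  rw [← mulIcc_shift, Nat.add_sub_cancel]
  refine mulIcc_congr fun i h₁ h₂ => ?_
  rw [dOfCycle, if_neg (by omega), if_neg (by omega), Nat.add_sub_cancel]

theorem cycleOfD_dOfCycle {n i : ℕ} (hn : 3 ≤ n) (y : ℕ → G) (h₁ : 1 ≤ i) (h₂ : i ≤ n) :
    cycleOfD n (dOfCycle n y) i = y i := by
  unfold cycleOfD
  split_ifs with h h'
  · simp [dOfCycle, h]
  · rw [mulIcc_dOfCycle (by omega)]
    simp [dOfCycle, h', mul_assoc]
  · simp only [dOfCycle]
    rw [if_neg (by omega), if_neg (by omega), Nat.add_sub_cancel]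

theorem dOfCycle_cycleOfD {n i : ℕ} (hn : 3 ≤ n) (x : ℕ → G) (h₁ : 1 ≤ i) (h₂ : i ≤ n) :
    dOfCycle n (cycleOfD n x) i = x i := by
  unfold dOfCycle
  split_ifs with h h'
  · simp [cycleOfD, h]
  · rw [mulIcc_cycleOfD (by omega)]
    have : n ≠ 1 := by omega
    simp [cycleOfD, h', this, mul_assoc]
  · simp only [cycleOfD]
    rw [if_neg (by omega), if_neg (by omega), Nat.sub_add_cancel h₁]

theorem map_dOfCycle {H : Type*} [Group H] (f : G →* H) (n : ℕ) (y : ℕ → G) (i : ℕ) :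
    f (dOfCycle n y i) = dOfCycle n (fun i => f (y i)) i := by
  unfold dOfCycle
  split_ifs <;> simp [map_mulIcc]

theorem map_cycleOfD {H : Type*} [Group H] (f : G →* H) (n : ℕ) (x : ℕ → G) (i : ℕ) :
    f (cycleOfD n x i) = cycleOfD n (fun i => f (x i)) i := by
  unfold cycleOfD
  split_ifs <;> simp [map_mulIcc]

theorem dOfCycle_congr {n i : ℕ} (hn : 3 ≤ n) {y z : ℕ → G} (h : ∀ i, 1 ≤ i → i ≤ n → y i = z i)
    (h₁ : 1 ≤ i) (h₂ : i ≤ n) : dOfCycle n y i = dOfCycle n z i := by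
  have e : mulIcc y 2 (n - 1) = mulIcc z 2 (n - 1) :=
    mulIcc_congr fun i h₁ h₂ => h i (by omega) (by omega)
  unfold dOfCycle
  split_ifs
  · exact h 1 le_rfl (by omega)
  · rw [e, h n (by omega) le_rfl]
  · exact h _ (by omega) (by omega)

theorem cycleOfD_congr {n i : ℕ} (hn : 3 ≤ n) {y z : ℕ → G} (h : ∀ i, 1 ≤ i → i ≤ n → y i = z i)
    (h₁ : 1 ≤ i) (h₂ : i ≤ n) : cycleOfD n y i = cycleOfD n z i := by
  have e : mulIcc y 3 n = mulIcc z 3 n :=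
    mulIcc_congr fun i h₁ h₂ => h i (by omega) (by omega)
  unfold cycleOfD
  split_ifs
  · exact h 1 le_rfl (by omega)
  · rw [e, h 2 (by omega) (by omega)]
  · exact h _ (by omega) (by omega)

theorem ArtinRels.dOfCycle {n : ℕ} (hn : 4 ≤ n) {y : ℕ → G} (h : ArtinRels n (cycEdge n) y)
    (hc : cc y n = 1) : ArtinRels n (dEdge n) (dOfCycle n y) := by
  obtain ⟨m, rfl⟩ := Nat.exists_eq_add_of_le' (show 1 ≤ n by omega)
  have line : IsLine y 2 (m + 1) :=
    ⟨fun i h₁ h₂ => h.br i _ (by omega) (by omega) h₂ (by unfold cycEdge; omega),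
      fun i j h₁ h₂ h₃ => h.comm i j (by omega) (by omega) h₃ (by unfold cycEdge; omega)⟩
  rw [cc, commutatorElement_eq_one_iff_commute, Nat.add_sub_cancel] at hc
  constructor
  · intro i j hi hij hj hE
    simp only [dEdge] at hE
    simp only [ArtinPaper.dOfCycle, Nat.add_sub_cancel]
    by_cases h1 : i = 1
    · rw [if_pos h1, if_neg (by omega), if_neg (by omega)]
      exact h.br 1 _ le_rfl (by omega) (by omega) (by unfold cycEdge; omega)
    by_cases h2 : i = 2
    · rw [if_neg h1, if_pos h2, if_neg (by omega), if_neg (by omega), show j - 1 = 2 by omega]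
      exact line.br_band_left (by omega)
    · rw [if_neg h1, if_neg h2, if_neg (by omega), if_neg (by omega)]
      exact h.br _ _ (by omega) (by omega) (by omega) (by unfold cycEdge; omega)
  · intro i j hi hij hj hE
    simp only [dEdge] at hE
    simp only [ArtinPaper.dOfCycle, Nat.add_sub_cancel]
    by_cases h1 : i = 1
    · by_cases h2 : j = 2
      · rw [if_pos h1, if_neg (by omega), if_pos h2]
        exact hc
      rw [if_pos h1, if_neg (by omega), if_neg h2]
      exact h.comm 1 _ le_rfl (by omega) (by omega) (by unfold cycEdge; omega)
    by_cases h2 : i = 2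
    · rw [if_neg h1, if_pos h2, if_neg (by omega), if_neg (by omega)]
      exact line.commute_band (by omega) (by omega)
    · rw [if_neg h1, if_neg h2, if_neg (by omega), if_neg (by omega)]
      exact h.comm _ _ (by omega) (by omega) (by omega) (by unfold cycEdge; omega)

theorem ArtinRels.cycleOfD {n : ℕ} (hn : 4 ≤ n) {x : ℕ → G} (h : ArtinRels n (dEdge n) x) :
    ArtinRels n (cycEdge n) (cycleOfD n x) := by
  obtain ⟨m, rfl⟩ := Nat.exists_eq_add_of_le' (show 1 ≤ n by omega)
  have line : IsLine x 2 (m + 1) :=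
    ⟨fun i h₁ h₂ => h.br i _ (by omega) (by omega) h₂ (by unfold dEdge; omega),
      fun i j h₁ h₂ h₃ => h.comm i j (by omega) (by omega) h₃ (by unfold dEdge; omega)⟩
  have h12 : Commute (x 1) (x 2) := h.comm 1 2 le_rfl (by omega) (by omega)
    (by unfold dEdge; omega)
  have h13 : BR (x 1) (x 3) := h.br 1 3 le_rfl (by omega) (by omega) (by simp [dEdge])
  have h23 : BR (x 2) (x 3) := line.br 2 le_rfl (by omega)
  have h1n : BR (x 1) ((mulIcc x 3 (m + 1))⁻¹ * x 2 * mulIcc x 3 (m + 1)) := by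
    have e : BR (x 1) ((x 3)⁻¹ * x 2 * x 3) := by
      rw [h23.inv_mul_mul]
      simpa [h12.symm.mul_mul_inv_eq] using h13.conj (x 2)
    have hc : Commute (x 1) (mulIcc x 4 (m + 1)) := commute_mulIcc fun j h₁ h₂ =>
      h.comm 1 j le_rfl (by omega) h₂ (by unfold dEdge; omega)
    rw [mulIcc_eq_mul x (show 3 ≤ m + 1 by omega)]
    simpa [hc.symm.inv_mul_mul_eq, mul_assoc] using e.conj' (mulIcc x 4 (m + 1))
  have band := line.conj_eq (by omega)
  constructor
  · intro i j hi hij hj hE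
    simp only [cycEdge] at hE
    simp only [ArtinPaper.cycleOfD]
    by_cases h1 : i = 1
    · by_cases h2 : j = m + 1
      · rw [if_pos h1, if_neg (by omega), if_pos h2]
        exact h1n
      rw [if_pos h1, if_neg (by omega), if_neg h2]
      exact h.br 1 _ le_rfl (by omega) (by omega) (by unfold dEdge; omega)
    by_cases h2 : j = m + 1
    · rw [if_neg h1, if_neg (by omega), if_neg (by omega), if_pos h2, ← band,
        show i + 1 = m + 1 by omega]
      exact (line.br_band_right (by omega)).symm
    · rw [if_neg h1, if_neg (by omega), if_neg (by omega), if_neg h2]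
      exact h.br _ _ (by omega) (by omega) (by omega) (by unfold dEdge; omega)
  · intro i j hi hij hj hE
    simp only [cycEdge] at hE
    simp only [ArtinPaper.cycleOfD]
    by_cases h1 : i = 1
    · rw [if_pos h1, if_neg (by omega), if_neg (by omega)]
      exact h.comm 1 _ le_rfl (by omega) (by omega) (by unfold dEdge; omega)
    by_cases h2 : j = m + 1
    · rw [if_neg h1, if_neg (by omega), if_neg (by omega), if_pos h2, ← band]
      exact (line.commute_band (by omega) (by omega)).symm
    · rw [if_neg h1, if_neg (by omega), if_neg (by omega), if_neg h2]
      exact h.comm _ _ (by omega) (by omega) (by omega) (by unfold dEdge; omega)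

theorem cc_cycleOfD {n : ℕ} (hn : 4 ≤ n) {x : ℕ → G} (h : ArtinRels n (dEdge n) x) :
    cc (cycleOfD n x) n = 1 := by
  have := dOfCycle_cycleOfD (i := 2) (by omega : 3 ≤ n) x (by omega) (by omega)
  rw [dOfCycle, if_neg (by omega), if_pos rfl] at this
  rw [cc, commutatorElement_eq_one_iff_commute, this]
  exact h.comm 1 2 le_rfl (by omega) (by omega) (by unfold dEdge; omega)

theorem cc_congr {n : ℕ} (hn : 1 ≤ n) {y z : ℕ → G} (h : ∀ i, 1 ≤ i → i ≤ n → y i = z i) :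
    cc y n = cc z n := by
  rw [cc, cc, h 1 le_rfl hn, h n hn le_rfl,
    mulIcc_congr fun i (h₁ : 2 ≤ i) (h₂ : i ≤ n - 1) => h i (by omega) (by omega)]

end Presentation

/-- Proposition 3.1: for `n ≥ 4`, the Artin group `A(D_n)` is
isomorphic to the quotient of `A(Δ_n)` by the normal closure of the cycle
commutator `cc(a_1, …, a_n)`. -/
theorem ArtinD_isom_cycle_quotient (n : ℕ) (hn : 4 ≤ n) :
    Nonempty (ArtinD n ≃* PresentedGroup (cycleRels n ∪ {cc (gen n) n})) := by
  set C := cycleRels n ∪ {cc (gen n) n}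
  have hx : ArtinRels n (dEdge n) fun i => PresentedGroup.mk (dRels n) (gen n i) :=
    artinRels_of_map _ fun r hr => PresentedGroup.one_of_mem hr
  have hy : ArtinRels n (cycEdge n) fun i => PresentedGroup.mk C (gen n i) :=
    artinRels_of_map _ fun r hr => PresentedGroup.one_of_mem (Or.inl hr)
  have hcc : cc (fun i => PresentedGroup.mk C (gen n i)) n = 1 := by
    rw [← map_cc]
    exact PresentedGroup.one_of_mem (Or.inr rfl)
  have hf : ∀ r ∈ dRels n, FreeGroup.lift (fun k : Fin n =>
      dOfCycle n (fun i => PresentedGroup.mk C (gen n i)) (k + 1)) r = 1 :=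
    fun r hr => (hy.dOfCycle hn hcc).lift_eq_one hr
  have hg : ∀ r ∈ C, FreeGroup.lift (fun k : Fin n =>
      cycleOfD n (fun i => PresentedGroup.mk (dRels n) (gen n i)) (k + 1)) r = 1 := by
    rintro r (hr | rfl)
    · exact (hx.cycleOfD hn).lift_eq_one hr
    · rw [map_cc, cc_congr (by omega) fun i h₁ h₂ => lift_gen _ h₁ h₂, cc_cycleOfD hn hx]
  refine ⟨MonoidHom.toMulEquiv (PresentedGroup.toGroup hf) (PresentedGroup.toGroup hg)
    (hom_ext_gen fun i h₁ h₂ => ?_) (hom_ext_gen fun i h₁ h₂ => ?_)⟩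
  · rw [MonoidHom.comp_apply, lift_mk_gen hf h₁ h₂, map_dOfCycle,
      dOfCycle_congr (by omega) (fun i h₁ h₂ => lift_mk_gen hg h₁ h₂) h₁ h₂,
      dOfCycle_cycleOfD (by omega) _ h₁ h₂, MonoidHom.id_apply]
  · rw [MonoidHom.comp_apply, lift_mk_gen hg h₁ h₂, map_cycleOfD,
      cycleOfD_congr (by omega) (fun i h₁ h₂ => lift_mk_gen hf h₁ h₂) h₁ h₂,
      cycleOfD_dOfCycle (by omega) _ h₁ h₂, MonoidHom.id_apply]

end ArtinPaper
end

section
/- Let n > 4 and let G = A(Δ_n). Let σ : G → Sym(n) be the homomorphism with σ(a_i) = (i, i+1) for 1 ≤ i ≤ n−1 and σ(a_n) = (1, n), and let H ≤ G be the preimage under σ of the setwise stabiliser in Sym(n) of the unordered pair {1, 2}. Then the abelianisation H/[H,H] is free abelian of rank 4, i.e. H/[H,H] ≅ ℤ^4. -/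
/- Scaffolding: braid/commuting predicates, ordered products, cycle and twisted
cycle commutators, and the Artin groups of the diagrams `Δ_n`, `Δ_{t,n}`, `D_n`
(generators numbered `1, …, n` as in the paper, realized on the index type `Fin n`). -/

namespace ArtinPaper

open scoped commutatorElement

/-! ### Normal generation of the stabiliser of a pair of adjacent points -/

/-- A group generated by `a 0, …, a (n-1)`, satisfying the relations of the `n`-cycle, acting on
the points `pt 0, …, pt (n-1)` in such a way that `a i` exchanges `pt i` and `pt (i+1)`, where
`pt n = pt 0`. -/
structure CycleAction (n : ℕ) {G X : Type*} [Group G] [DecidableEq X]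
    (ρ : G →* Equiv.Perm X) (pt : ℕ → X) (a : ℕ → G) : Prop where
  pt_inj : ∀ i j, i < n → j < n → pt i = pt j → i = j
  pt_surj : ∀ x, ∃ i < n, pt i = x
  pt_wrap : pt n = pt 0
  map_gen : ∀ i < n, ρ (a i) = Equiv.swap (pt i) (pt (i + 1))
  braid : ∀ i, i + 1 < n → a i * a (i + 1) * a i = a (i + 1) * a i * a (i + 1)
  comm : ∀ i j, i + 1 < j → j < n → ¬ (i = 0 ∧ j + 1 = n) → a i * a j = a j * a i
  closure_gen : Subgroup.closure {g | ∃ i < n, a i = g} = ⊤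

/-- `ascend a s k = a (s+k-1) * ⋯ * a (s+1) * a s`. -/
def ascend {G : Type*} [Group G] (a : ℕ → G) (s : ℕ) : ℕ → G
  | 0 => 1
  | k + 1 => a (s + k) * ascend a s k

/-- An element carrying the pair `{0, 1}` to the pair `{p, q}`, for `p < q`. -/
def pairRep {G : Type*} [Group G] (a : ℕ → G) (p q : ℕ) : G :=
  ascend a 0 p * ascend a 1 (q - 1)

/-- Conjugating `g` back to the base pair `z₀` along any element carrying `z₀` to `z` gives an
element of `K`. -/
def LoopIn {G X : Type*} [Group G] (ρ : G →* Equiv.Perm X) (z₀ : Sym2 X) (K : Subgroup G)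
    (g : G) (z : Sym2 X) : Prop :=
  ∀ t, z₀.map (ρ t) = z → t⁻¹ * g * t ∈ K

namespace LoopIn

variable {G X : Type*} [Group G] {ρ : G →* Equiv.Perm X} {z₀ z : Sym2 X} {K : Subgroup G}

lemma map_mul (g h : G) (z : Sym2 X) : z.map (ρ (g * h)) = (z.map (ρ h)).map (ρ g) := by
  simp [Sym2.map_map, Equiv.Perm.coe_mul]

lemma map_inv_map (g : G) (z : Sym2 X) : (z.map (ρ g)).map (ρ g⁻¹) = z := by
  rw [← map_mul]; simp

lemma map_map_inv (g : G) (z : Sym2 X) : (z.map (ρ g⁻¹)).map (ρ g) = z := by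
  rw [← map_mul]; simp

lemma conj {a b g : G} (h : LoopIn ρ z₀ K a z) (hg : b * g = g * a) :
    LoopIn ρ z₀ K b (z.map (ρ g)) := by
  intro t ht
  have h1 := h (g⁻¹ * t) (by rw [map_mul, ht, map_inv_map])
  have h2 : b = g * a * g⁻¹ := by rw [← hg]; group
  convert h1 using 1
  rw [h2]; group

lemma of_mem {a t : G} (hK : ∀ h k, z₀.map (ρ h) = z₀ → k ∈ K → h * k * h⁻¹ ∈ K)
    (ht : z₀.map (ρ t) = z) (h : t⁻¹ * a * t ∈ K) : LoopIn ρ z₀ K a z := by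
  intro t' ht'
  have h1 := hK (t'⁻¹ * t) _ (by rw [map_mul, ht, ← ht', map_inv_map]) h
  convert h1 using 1
  group

lemma pow_two {a : G} (h : LoopIn ρ z₀ K a z) : LoopIn ρ z₀ K (a ^ 2) z := by
  intro t ht
  have := K.mul_mem (h t ht) (h t ht)
  convert this using 1
  rw [sq]; group

end LoopIn

namespace CycleAction

variable {n : ℕ} {G X : Type*} [Group G] [DecidableEq X] {ρ : G →* Equiv.Perm X} {pt : ℕ → X}
  {a : ℕ → G} {K : Subgroup G}

section Action

variable (A : CycleAction n ρ pt a)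
include A

lemma pt_ne {i j : ℕ} (hi : i < n) (hj : j < n) (h : i ≠ j) : pt i ≠ pt j :=
  fun e => h (A.pt_inj i j hi hj e)

lemma gen_left {i : ℕ} (hi : i < n) : ρ (a i) (pt i) = pt (i + 1) := by
  rw [A.map_gen i hi, Equiv.swap_apply_left]

lemma gen_right {i : ℕ} (hi : i < n) : ρ (a i) (pt (i + 1)) = pt i := by
  rw [A.map_gen i hi, Equiv.swap_apply_right]

lemma gen_of_ne {i j : ℕ} (hi : i + 1 < n) (hj : j < n) (h : j ≠ i) (h' : j ≠ i + 1) :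
    ρ (a i) (pt j) = pt j := by
  rw [A.map_gen i (by omega), Equiv.swap_apply_of_ne_of_ne (A.pt_ne hj (by omega) h)
    (A.pt_ne hj hi h')]

lemma gen_last_of_ne {i j : ℕ} (hi : i + 1 = n) (hj : j < n) (h : j ≠ i) (h' : j ≠ 0) :
    ρ (a i) (pt j) = pt j := by
  rw [A.map_gen i (by omega), hi, A.pt_wrap, Equiv.swap_apply_of_ne_of_ne
    (A.pt_ne hj (by omega) h) (A.pt_ne hj (by omega) h')]

lemma ascend_fix {s k j : ℕ} (hk : s + k < n) (hj : j < n) (h : j < s ∨ s + k < j) :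
    ρ (ascend a s k) (pt j) = pt j := by
  induction k with
  | zero => simp [ascend]
  | succ k ih =>
    rw [ascend, _root_.map_mul, Equiv.Perm.mul_apply, ih (by omega) (by omega)]
    exact A.gen_of_ne (by omega) hj (by omega) (by omega)

lemma ascend_apply {s k : ℕ} (hk : s + k < n) : ρ (ascend a s k) (pt s) = pt (s + k) := by
  induction k with
  | zero => simp [ascend]
  | succ k ih =>
    rw [ascend, _root_.map_mul, Equiv.Perm.mul_apply, ih (by omega)]
    exact A.gen_left (by omega)

lemma pairRep_map {p q : ℕ} (hpq : p < q) (hq : q < n) :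
    (s(pt 0, pt 1)).map (ρ (pairRep a p q)) = s(pt p, pt q) := by
  have h1 := A.ascend_fix (s := 1) (k := q - 1) (j := 0) (by omega) (by omega) (by omega)
  have h2 := A.ascend_apply (s := 1) (k := q - 1) (by omega)
  have h3 := A.ascend_apply (s := 0) (k := p) (by omega)
  have h4 := A.ascend_fix (s := 0) (k := p) (j := q) (by omega) (by omega) (by omega)
  rw [show 1 + (q - 1) = q by omega] at h2
  rw [zero_add] at h3
  simp [pairRep, h1, h2, h3, h4]

omit [DecidableEq X] A in
lemma gen_mul_pairRep_left {p q : ℕ} : a p * pairRep a p q = pairRep a (p + 1) q := by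
  simp [pairRep, ascend, mul_assoc]

lemma comm_ascend {p q : ℕ} (hpq : p < q) (hq : q + 1 < n) :
    a q * ascend a 0 p = ascend a 0 p * a q := by
  induction p with
  | zero => simp [ascend]
  | succ p ih =>
    rw [ascend, zero_add, mul_assoc, ← ih (by omega), ← mul_assoc,
      ← A.comm p q (by omega) (by omega) (by omega), mul_assoc]

lemma gen_mul_pairRep_right {p q : ℕ} (hpq : p < q) (hq : q + 1 < n) :
    a q * pairRep a p q = pairRep a p (q + 1) := by
  obtain ⟨q, rfl⟩ : ∃ r, q = r + 1 := ⟨q - 1, by omega⟩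
  simp only [pairRep, Nat.add_sub_cancel, ascend]
  rw [← mul_assoc, A.comm_ascend hpq hq, mul_assoc, add_comm 1 q]

lemma gen_last_mul_pairRep {p m : ℕ} (hm : m + 1 = n) (hp : 1 ≤ p) (hpm : p < m) :
    (pairRep a 0 p)⁻¹ * a m * pairRep a p m = a m * pairRep a 1 m := by
  induction p, hp using Nat.le_induction with
  | base => simp [pairRep, ascend]
  | succ p hp ih =>
    rw [← ih (by omega), ← gen_mul_pairRep_left (p := p), ← A.gen_mul_pairRep_right (p := 0)
      (q := p) (by omega) (by omega)]
    have := A.comm p m (by omega) (by omega) (by omega)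
    rw [mul_inv_rev, ← mul_assoc, mul_assoc _ (a m), ← this]
    group

/-- All loops based at pairs fixed by `a i`, and all loops given by `a i ^ 2`, are trivial as soon
as this holds for `i = 0`. -/
lemma loops_of_zero
    (h0 : ∀ z : Sym2 X, ¬ z.IsDiag → LoopIn ρ s(pt 0, pt 1) K (a 0 ^ 2) z ∧
      (z.map (ρ (a 0)) = z → LoopIn ρ s(pt 0, pt 1) K (a 0) z)) {i : ℕ} (hi : i < n) :
    ∀ z : Sym2 X, ¬ z.IsDiag → LoopIn ρ s(pt 0, pt 1) K (a i ^ 2) z ∧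
      (z.map (ρ (a i)) = z → LoopIn ρ s(pt 0, pt 1) K (a i) z) := by
  induction i with
  | zero => exact h0
  | succ i ih =>
    intro z hz
    have hg : a (i + 1) * (a i * a (i + 1)) = a i * a (i + 1) * a i := by
      rw [A.braid i hi, mul_assoc]
    have hg2 : a (i + 1) ^ 2 * (a i * a (i + 1)) = a i * a (i + 1) * a i ^ 2 := by
      rw [sq, mul_assoc, hg, ← mul_assoc, hg, mul_assoc _ (a i) (a i), ← sq]
    set g := a i * a (i + 1)
    have hz' : ¬ (z.map (ρ g⁻¹)).IsDiag := by
      rwa [Sym2.isDiag_map (ρ g⁻¹).injective]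
    obtain ⟨h1, h2⟩ := ih (by omega) _ hz'
    have e := LoopIn.map_map_inv (ρ := ρ) g z
    refine ⟨e ▸ h1.conj hg2, fun hfix => ?_⟩
    have := (h2 ?_).conj hg
    · rwa [e] at this
    · have : a i * g⁻¹ = g⁻¹ * a (i + 1) := by
        rw [eq_inv_mul_iff_mul_eq, ← mul_assoc, ← hg]; group
      rw [← LoopIn.map_mul, this, LoopIn.map_mul, hfix]

end Action

section Stabilizer

variable (A : CycleAction n ρ pt a) (hn : 5 ≤ n)
  (hK : ∀ h k, (s(pt 0, pt 1)).map (ρ h) = s(pt 0, pt 1) → k ∈ K → h * k * h⁻¹ ∈ K)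
  (h0 : a 0 ∈ K) (h1 : a 1 ^ 2 ∈ K) (h2 : a 2 ∈ K)
include A hn hK

include h2 in
lemma loop_zero_of_disjoint {p q : ℕ} (hp : 2 ≤ p) (hpq : p < q) (hq : q < n) :
    LoopIn ρ s(pt 0, pt 1) K (a 0) s(pt p, pt q) := by
  have comm0 : ∀ j, 2 ≤ j → j + 1 < n → a 0 * a j = a j * a 0 := fun j hj hj' =>
    A.comm 0 j (by omega) (by omega) (by omega)
  have base : LoopIn ρ s(pt 0, pt 1) K (a 0) s(pt 2, pt 3) := by
    have h : LoopIn ρ s(pt 0, pt 1) K (a 2) s(pt 0, pt 1) :=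
      LoopIn.of_mem (t := 1) hK (by simp) (by simpa using h2)
    have hconj : a 0 * (a 1 * a 0 * (a 2 * a 1)) = a 1 * a 0 * (a 2 * a 1) * a 2 := by
      have b0 := A.braid 0 (by omega)
      have b1 := A.braid 1 (by omega)
      simp only [zero_add, Nat.reduceAdd] at b0 b1
      calc a 0 * (a 1 * a 0 * (a 2 * a 1)) = a 0 * a 1 * a 0 * (a 2 * a 1) := by group
        _ = a 1 * a 0 * (a 1 * a 2 * a 1) := by rw [b0]; group
        _ = a 1 * a 0 * (a 2 * a 1) * a 2 := by rw [b1]; group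
    have e := h.conj hconj
    have e1 := A.gen_of_ne (i := 1) (j := 0) (by omega) (by omega) (by omega) (by omega)
    have e2 := A.gen_of_ne (i := 2) (j := 0) (by omega) (by omega) (by omega) (by omega)
    have e3 := A.gen_left (i := 0) (by omega)
    have e4 := A.gen_left (i := 1) (by omega)
    have e5 := A.gen_left (i := 2) (by omega)
    have e6 := A.gen_of_ne (i := 0) (j := 3) (by omega) (by omega) (by omega) (by omega)
    have e7 := A.gen_of_ne (i := 1) (j := 3) (by omega) (by omega) (by omega) (by omega)
    simp only [zero_add, Nat.reduceAdd] at e3 e4 e5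
    simpa [e1, e2, e3, e4, e5, e6, e7] using e
  have right : ∀ r, 3 ≤ r → r < n → LoopIn ρ s(pt 0, pt 1) K (a 0) s(pt 2, pt r) := by
    intro r hr
    induction r, hr using Nat.le_induction with
    | base => exact fun _ => base
    | succ r hr ih =>
      intro hrn
      have := (ih (by omega)).conj (comm0 r (by omega) hrn)
      rwa [Sym2.map_mk, A.gen_left (by omega),
        A.gen_of_ne hrn (by omega) (by omega) (by omega)] at this
  induction p, hp using Nat.le_induction with
  | base => exact right q (by omega) hq
  | succ p hp ih =>
    have := (ih (by omega)).conj (comm0 p (by omega) (by omega))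
    rwa [Sym2.map_mk, A.gen_left (by omega),
      A.gen_of_ne (by omega) (by omega) (by omega) (by omega)] at this

include h1 in
lemma loop_zero_sq {q : ℕ} (hq2 : 2 ≤ q) (hq : q < n) :
    LoopIn ρ s(pt 0, pt 1) K (a 0 ^ 2) s(pt 0, pt q) := by
  induction q, hq2 using Nat.le_induction with
  | base =>
    have h : LoopIn ρ s(pt 0, pt 1) K (a 1 ^ 2) s(pt 0, pt 1) :=
      LoopIn.of_mem (t := 1) hK (by simp) (by simpa using h1)
    have b0 := A.braid 0 (by omega)
    simp only [zero_add] at b0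
    have hconj : a 0 ^ 2 * (a 1 * a 0) = a 1 * a 0 * a 1 ^ 2 := by
      calc a 0 ^ 2 * (a 1 * a 0) = a 0 * (a 0 * a 1 * a 0) := by rw [sq]; group
        _ = a 0 * (a 1 * a 0 * a 1) := by rw [b0]
        _ = a 0 * a 1 * a 0 * a 1 := by simp only [mul_assoc]
        _ = a 1 * a 0 * a 1 ^ 2 := by rw [b0, sq]; group
    have e := h.conj hconj
    have e1 := A.gen_left (i := 0) (by omega)
    have e2 := A.gen_left (i := 1) (by omega)
    have e3 := A.gen_right (i := 0) (by omega)
    have e4 := A.gen_of_ne (i := 1) (j := 0) (by omega) (by omega) (by omega) (by omega)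
    simp only [zero_add, Nat.reduceAdd] at e1 e2 e3
    simp only [Sym2.map_mk, _root_.map_mul, Equiv.Perm.mul_apply, e1, e2, e3, e4] at e
    rwa [Sym2.eq_swap (a := pt 0) (b := pt 2)]
  | succ q hq2 ih =>
    have hc : Commute (a 0) (a q) := A.comm 0 q (by omega) (by omega) (by omega)
    have := (ih (by omega)).conj (hc.pow_left 2).eq
    rwa [Sym2.map_mk, A.gen_left (by omega),
      A.gen_of_ne hq (by omega) (by omega) (by omega)] at this

include h0 h1 h2 in
lemma loops_zero (z : Sym2 X) (hz : ¬ z.IsDiag) :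
    LoopIn ρ s(pt 0, pt 1) K (a 0 ^ 2) z ∧
      (z.map (ρ (a 0)) = z → LoopIn ρ s(pt 0, pt 1) K (a 0) z) := by
  have key : ∀ p q, p < q → q < n → LoopIn ρ s(pt 0, pt 1) K (a 0 ^ 2) s(pt p, pt q) ∧
      ((s(pt p, pt q)).map (ρ (a 0)) = s(pt p, pt q) →
        LoopIn ρ s(pt 0, pt 1) K (a 0) s(pt p, pt q)) := by
    intro p q hpq hq
    have e1 := A.gen_left (i := 0) (by omega)
    have e2 := A.gen_right (i := 0) (by omega)
    rw [zero_add] at e1 e2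
    obtain hp | rfl | rfl : 2 ≤ p ∨ p = 0 ∨ p = 1 := by omega
    · have := loop_zero_of_disjoint A hn hK h2 hp hpq hq
      exact ⟨this.pow_two, fun _ => this⟩
    · obtain rfl | hq2 : q = 1 ∨ 2 ≤ q := by omega
      · have h : LoopIn ρ s(pt 0, pt 1) K (a 0) s(pt 0, pt 1) :=
          LoopIn.of_mem (t := 1) hK (by simp) (by simpa using h0)
        exact ⟨h.pow_two, fun _ => h⟩
      · refine ⟨loop_zero_sq A hn hK h1 hq2 hq, fun h => ?_⟩
        rw [Sym2.map_mk, e1, A.gen_of_ne (by omega) hq (by omega) (by omega)] at h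
        simp [A.pt_ne (i := 1) (j := q) (by omega) (by omega) (by omega),
          A.pt_ne (i := 1) (j := 0) (by omega) (by omega) (by omega)] at h
    · have := (loop_zero_sq A hn hK h1 (q := q) (by omega) hq).conj
        (g := a 0) (b := a 0 ^ 2) (by rw [← pow_succ, ← pow_succ'])
      rw [Sym2.map_mk, e1, A.gen_of_ne (by omega) hq (by omega) (by omega)] at this
      refine ⟨this, fun h => ?_⟩
      rw [Sym2.map_mk, e2, A.gen_of_ne (by omega) hq (by omega) (by omega)] at h
      simp [A.pt_ne (i := 0) (j := 1) (by omega) (by omega) (by omega),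
        A.pt_ne (i := 0) (j := q) (by omega) (by omega) (by omega)] at h
  induction z with | _ x y =>
  obtain ⟨p, hp, rfl⟩ := A.pt_surj x
  obtain ⟨q, hq, rfl⟩ := A.pt_surj y
  obtain h | rfl | h := lt_trichotomy p q
  · exact key p q h hq
  · simp at hz
  · rw [Sym2.eq_swap (a := pt p)]
    exact key q p h hp

include h0 h1 h2 in
/-- The left cosets `pairRep a p q * K` are permuted by the generators. -/
lemma gen_mul_pairRep_mem {m : ℕ} (hm : m + 1 = n) (h3 : a m * pairRep a 1 m ∈ K)
    {i p q : ℕ} (hi : i < n) (hpq : p < q) (hq : q < n) :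
    ∃ p' q', p' < q' ∧ q' < n ∧ (pairRep a p' q')⁻¹ * (a i * pairRep a p q) ∈ K := by
  have loops := fun {i} (hi : i < n) =>
    A.loops_of_zero (loops_zero A hn hK h0 h1 h2) hi
  have nd : ∀ {p q}, p < q → q < n → ¬ (s(pt p, pt q)).IsDiag := fun hpq hq => by
    simpa using A.pt_ne (by omega) hq (by omega)
  have fixed : (s(pt p, pt q)).map (ρ (a i)) = s(pt p, pt q) →
      ∃ p' q', p' < q' ∧ q' < n ∧ (pairRep a p' q')⁻¹ * (a i * pairRep a p q) ∈ K := fun h => by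
    refine ⟨p, q, hpq, hq, ?_⟩
    rw [← mul_assoc]
    exact (loops hi _ (nd hpq hq)).2 h _ (A.pairRep_map hpq hq)
  have back : ∀ p' q', p' < q' → q' < n → (pairRep a p q)⁻¹ * (a i * pairRep a p' q') ∈ K →
      ∃ p' q', p' < q' ∧ q' < n ∧ (pairRep a p' q')⁻¹ * (a i * pairRep a p q) ∈ K := by
    intro p' q' h h' hmem
    refine ⟨p', q', h, h', ?_⟩
    have := (loops hi _ (nd h h')).1 _ (A.pairRep_map h h')
    convert K.mul_mem this (K.inv_mem hmem) using 1
    rw [sq]; group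
  by_cases hqi : q = i
  · subst hqi
    by_cases hqm : q = m
    · subst hqm
      obtain rfl | hp : p = 0 ∨ 1 ≤ p := by omega
      · apply fixed
        have e1 := A.gen_left hi
        have e2 := A.gen_right hi
        rw [hm, A.pt_wrap] at e1 e2
        rw [Sym2.map_mk, e1, e2, Sym2.eq_swap]
      · refine ⟨0, p, by omega, by omega, ?_⟩
        rwa [← mul_assoc, A.gen_last_mul_pairRep hm hp hpq]
    · refine ⟨p, q + 1, by omega, by omega, ?_⟩
      rw [A.gen_mul_pairRep_right hpq (by omega), inv_mul_cancel]
      exact K.one_mem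
  by_cases hpi : p = i
  · subst hpi
    by_cases hq' : q = p + 1
    · subst hq'
      apply fixed
      rw [Sym2.map_mk, A.gen_left hi, A.gen_right hi, Sym2.eq_swap]
    · refine ⟨p + 1, q, by omega, hq, ?_⟩
      rw [gen_mul_pairRep_left, inv_mul_cancel]
      exact K.one_mem
  by_cases him : i = m
  · subst him
    obtain rfl | hp : p = 0 ∨ 1 ≤ p := by omega
    · apply back q i (by omega) (by omega)
      rwa [← mul_assoc, A.gen_last_mul_pairRep hm (by omega) (by omega)]
    · apply fixed
      rw [Sym2.map_mk, A.gen_last_of_ne hm (by omega) (by omega) (by omega),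
        A.gen_last_of_ne hm (by omega) (by omega) (by omega)]
  by_cases hpi' : p = i + 1
  · subst hpi'
    apply back i q (by omega) hq
    rw [gen_mul_pairRep_left, inv_mul_cancel]
    exact K.one_mem
  by_cases hqi' : q = i + 1
  · subst hqi'
    apply back p i (by omega) (by omega)
    rw [A.gen_mul_pairRep_right (by omega) (by omega), inv_mul_cancel]
    exact K.one_mem
  apply fixed
  rw [Sym2.map_mk, A.gen_of_ne (by omega) (by omega) (by omega) (by omega),
    A.gen_of_ne (by omega) (by omega) (by omega) (by omega)]

include h0 h1 h2 in
/-- The stabiliser of `{0, 1}` is normally generated by four elements. -/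
theorem mem_of_map_eq {m : ℕ} (hm : m + 1 = n) (h3 : a m * pairRep a 1 m ∈ K) {g : G}
    (hg : (s(pt 0, pt 1)).map (ρ g) = s(pt 0, pt 1))
    (hKle : ∀ k ∈ K, (s(pt 0, pt 1)).map (ρ k) = s(pt 0, pt 1)) : g ∈ K := by
  have key : ∃ p q, p < q ∧ q < n ∧ (pairRep a p q)⁻¹ * g ∈ K := by
    have hgc : g ∈ Subgroup.closure {g | ∃ i < n, a i = g} := by
      rw [A.closure_gen]; trivial
    clear hg
    induction hgc using Subgroup.closure_induction_left with
    | one =>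
      refine ⟨0, 1, by omega, by omega, ?_⟩
      simp [pairRep, ascend, K.one_mem]
    | mul_left x hx y _ ih =>
      obtain ⟨i, hi, rfl⟩ := hx
      obtain ⟨p, q, hpq, hq, h⟩ := ih
      obtain ⟨p', q', hpq', hq', h'⟩ := gen_mul_pairRep_mem A hn hK h0 h1 h2 hm h3 hi hpq hq
      refine ⟨p', q', hpq', hq', ?_⟩
      convert K.mul_mem h' h using 1
      group
    | inv_mul_cancel x hx y _ ih =>
      obtain ⟨i, hi, rfl⟩ := hx
      obtain ⟨p, q, hpq, hq, h⟩ := ih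
      obtain ⟨p', q', hpq', hq', h'⟩ := gen_mul_pairRep_mem A hn hK h0 h1 h2 hm h3 hi hpq hq
      refine ⟨p', q', hpq', hq', ?_⟩
      have hsq := (A.loops_of_zero (loops_zero A hn hK h0 h1 h2) hi s(pt p, pt q)
        (by simpa using A.pt_ne (by omega) hq (by omega))).1 _ (A.pairRep_map hpq hq)
      convert K.mul_mem (K.mul_mem h' (K.inv_mem hsq)) h using 1
      rw [sq]; group
  obtain ⟨p, q, hpq, hq, h⟩ := key
  have e : s(pt p, pt q) = s(pt 0, pt 1) := by
    have := hKle _ h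
    rw [LoopIn.map_mul, hg] at this
    rw [← A.pairRep_map hpq hq, ← this, LoopIn.map_map_inv, this]
  have hp : p = 0 ∧ q = 1 := by
    simp only [Sym2.eq_iff] at e
    rcases e with ⟨e1, e2⟩ | ⟨e1, e2⟩
    · exact ⟨A.pt_inj _ _ (by omega) (by omega) e1, A.pt_inj _ _ (by omega) (by omega) e2⟩
    · have := A.pt_inj _ _ (by omega) (by omega) e1
      have := A.pt_inj _ _ (by omega) (by omega) e2
      omega
  obtain ⟨rfl, rfl⟩ := hp
  simpa [pairRep, ascend] using h

end Stabilizer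

end CycleAction

/-! ### Crossing numbers and winding number -/

section Cocycle

open scoped Pointwise

open Classical in
/-- The contribution of a crossing of two strands to, respectively, the number of crossings of
coloured strands, of strands of distinct colours, of uncoloured strands, and `ε` times the winding
number of the coloured strands; `P` and `Q` say whether the two strands are coloured. -/
noncomputable def crossing (P Q : Prop) (ε : ℤ) : Fin 4 → ℤ :=
  ![if P ∧ Q then 1 else 0, if P ↔ Q then 0 else 1, if P ∨ Q then 0 else 1,
    ε * ((if P then 1 else 0) - (if Q then 1 else 0))]

/-- Permutations of `Fin n` together with a `ℤ⁴`-valued function on the subsets of `Fin n`. -/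
abbrev CountedPerm (n : ℕ) :=
  (Set (Fin n) → Multiplicative (Fin 4 → ℤ)) ⋊[mulAutArrow] Equiv.Perm (Fin n)

/-- The transposition of `p` and `q`, with its crossing numbers. -/
noncomputable def countedSwap {n : ℕ} (p q : Fin n) (ε : ℤ) : CountedPerm n :=
  ⟨fun x => Multiplicative.ofAdd (crossing (p ∈ x) (q ∈ x) ε), Equiv.swap p q⟩

lemma mulAutArrow_swap_apply {n : ℕ} (p q : Fin n) (F : Set (Fin n) → Multiplicative (Fin 4 → ℤ))
    (x : Set (Fin n)) :
    (mulAutArrow (Equiv.swap p q) : MulAut _) F x = F (Equiv.swap p q • x) := by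
  change F ((Equiv.swap p q)⁻¹ • x) = _
  rw [Equiv.swap_inv]

lemma mem_swap_smul {n : ℕ} (p q r : Fin n) (x : Set (Fin n)) :
    r ∈ Equiv.swap p q • x ↔ Equiv.swap p q r ∈ x := by
  rw [Set.mem_smul_set_iff_inv_smul_mem, Equiv.swap_inv, Equiv.Perm.smul_def]

lemma countedSwap_mul_left {n : ℕ} (p q : Fin n) (ε : ℤ) (g : CountedPerm n) (x : Set (Fin n)) :
    ((countedSwap p q ε * g).left x).toAdd =
      crossing (p ∈ x) (q ∈ x) ε + (g.left (Equiv.swap p q • x)).toAdd := by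
  rw [SemidirectProduct.mul_left, Pi.mul_apply, toAdd_mul]
  exact congrArg _ (mulAutArrow_swap_apply p q g.left x)

lemma countedSwap_braid {n : ℕ} {p q r : Fin n} (hpq : p ≠ q) (hpr : p ≠ r) (hqr : q ≠ r)
    (ε δ : ℤ) : BR (countedSwap p q ε) (countedSwap q r δ) := by
  unfold BR
  rw [mul_assoc, mul_assoc]
  apply SemidirectProduct.ext
  · funext x
    apply Multiplicative.toAdd.injective
    rw [countedSwap_mul_left, countedSwap_mul_left, countedSwap_mul_left, countedSwap_mul_left]
    simp only [countedSwap, toAdd_ofAdd, mem_swap_smul, Equiv.swap_apply_left,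
      Equiv.swap_apply_right, Equiv.swap_apply_of_ne_of_ne hpr.symm hqr.symm,
      Equiv.swap_apply_of_ne_of_ne hpq hpr]
    by_cases h1 : p ∈ x <;> by_cases h2 : q ∈ x <;> by_cases h3 : r ∈ x <;>
      simp [crossing, h1, h2, h3]
  · ext k
    simp only [countedSwap, SemidirectProduct.mul_right, Equiv.Perm.mul_apply,
      Equiv.swap_apply_def]
    grind

lemma countedSwap_comm {n : ℕ} {p q r s : Fin n} (hpr : p ≠ r) (hps : p ≠ s) (hqr : q ≠ r)
    (hqs : q ≠ s) (ε δ : ℤ) : CM (countedSwap p q ε) (countedSwap r s δ) := by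
  unfold CM
  apply SemidirectProduct.ext
  · funext x
    apply Multiplicative.toAdd.injective
    rw [countedSwap_mul_left, countedSwap_mul_left]
    simp only [countedSwap, toAdd_ofAdd, mem_swap_smul,
      Equiv.swap_apply_of_ne_of_ne hpr hps, Equiv.swap_apply_of_ne_of_ne hqr hqs,
      Equiv.swap_apply_of_ne_of_ne hpr.symm hqr.symm,
      Equiv.swap_apply_of_ne_of_ne hps.symm hqs.symm]
    rw [add_comm]
  · ext k
    simp only [countedSwap, SemidirectProduct.mul_right, Equiv.Perm.mul_apply,
      Equiv.swap_apply_def]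
    grind

/-- The residue of `i` modulo `n`. -/
def cyclePt {n : ℕ} (hn : 0 < n) (i : ℕ) : Fin n := ⟨i % n, Nat.mod_lt _ hn⟩

lemma cyclePt_ne {n : ℕ} (hn : 0 < n) {i j : ℕ} (hi : i < n) (hj : j < n) (h : i ≠ j) :
    cyclePt hn i ≠ cyclePt hn j := by
  simpa [cyclePt, Fin.ext_iff, Nat.mod_eq_of_lt hi, Nat.mod_eq_of_lt hj] using h

lemma cyclePt_self {n : ℕ} (hn : 0 < n) : cyclePt hn n = cyclePt hn 0 := by
  simp [cyclePt]

lemma gen_succ {n : ℕ} (hn : 0 < n) (i : ℕ) : gen n (i + 1) = FreeGroup.of (cyclePt hn i) := by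
  simp [gen, hn, cyclePt]

/-- A homomorphism kills the relators of `A(Δ_n)` iff the images of the generators satisfy the braid
and commutation relations of the cycle. -/
lemma lift_cycleRels {n : ℕ} (hn : 2 < n) {M : Type*} [Group M] (F : FreeGroup (Fin n) →* M) :
    (∀ w ∈ cycleRels n, F w = 1) ↔
      (∀ i, i + 1 < n → BR (F (FreeGroup.of (cyclePt (by omega) i)))
        (F (FreeGroup.of (cyclePt (by omega) (i + 1))))) ∧
      BR (F (FreeGroup.of (cyclePt (by omega) 0))) (F (FreeGroup.of (cyclePt (by omega) (n - 1)))) ∧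
      ∀ i j, i + 1 < j → j < n → ¬ (i = 0 ∧ j + 1 = n) →
        CM (F (FreeGroup.of (cyclePt (by omega) i))) (F (FreeGroup.of (cyclePt (by omega) j))) := by
  have hbr : ∀ i j, F (braidRel (gen n (i + 1)) (gen n (j + 1))) = 1 ↔
      BR (F (FreeGroup.of (cyclePt (by omega) i))) (F (FreeGroup.of (cyclePt (by omega) j))) := by
    intro i j
    rw [gen_succ (by omega), gen_succ (by omega), braidRel, map_mul, map_inv, mul_inv_eq_one]
    simp [BR]
  have hcm : ∀ i j, F ⁅gen n (i + 1), gen n (j + 1)⁆ = 1 ↔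
      CM (F (FreeGroup.of (cyclePt (by omega) i))) (F (FreeGroup.of (cyclePt (by omega) j))) := by
    intro i j
    rw [gen_succ (by omega), gen_succ (by omega), map_commutatorElement,
      commutatorElement_eq_one_iff_mul_comm]
    rfl
  constructor
  · intro h
    refine ⟨fun i hi => (hbr _ _).1 (h _ ⟨i + 1, i + 2, by omega, by omega, by omega,
      Or.inl ⟨Or.inl ⟨by omega, by omega, by omega⟩, rfl⟩⟩),
      (hbr _ _).1 (h _ ⟨1, n - 1 + 1, by omega, by omega, by omega,
        Or.inl ⟨Or.inr ⟨rfl, by omega⟩, rfl⟩⟩),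
      fun i j hij hj hne => (hcm _ _).1 (h _ ⟨i + 1, j + 1, by omega, by omega, by omega,
        Or.inr ⟨?_, rfl⟩⟩)⟩
    unfold cycEdge
    omega
  · rintro ⟨h1, h2, h3⟩ w ⟨i, j, hi, hij, hj, ⟨he, rfl⟩ | ⟨he, rfl⟩⟩
    · obtain ⟨i, rfl⟩ : ∃ k, i = k + 1 := ⟨i - 1, by omega⟩
      obtain ⟨_, h, rfl⟩ | ⟨h, rfl⟩ := he
      · exact (hbr _ _).2 (h1 i (by omega))
      · obtain rfl : i = 0 := by omega
        obtain ⟨j, rfl⟩ : ∃ k, j = k + 1 := ⟨j - 1, by omega⟩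
        exact (hbr _ _).2 h2
    · obtain ⟨i, rfl⟩ : ∃ k, i = k + 1 := ⟨i - 1, by omega⟩
      obtain ⟨j, rfl⟩ : ∃ k, j = k + 1 := ⟨j - 1, by omega⟩
      unfold cycEdge at he
      exact (hcm _ _).2 (h3 i j (by omega) (by omega) (by omega))

/-- The image of a generator of `A(Δ_n)`; winding is measured between positions `n-1` and `0`. -/
noncomputable def countedGen {n : ℕ} (hn : 0 < n) (x : Fin n) : CountedPerm n :=
  countedSwap x ⟨(x.val + 1) % n, Nat.mod_lt _ hn⟩ (if x.val + 1 = n then 1 else 0)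

lemma countedGen_cyclePt {n : ℕ} (hn : 0 < n) {i : ℕ} (hi : i < n) :
    countedGen hn (cyclePt hn i) =
      countedSwap (cyclePt hn i) (cyclePt hn (i + 1)) (if i + 1 = n then 1 else 0) := by
  simp [countedGen, cyclePt, Nat.mod_eq_of_lt hi]

/-- The crossing and winding numbers on `A(Δ_n)`, as a homomorphism. -/
noncomputable def countHom {n : ℕ} (hn : 2 < n) : PresentedGroup (cycleRels n) →* CountedPerm n :=
  PresentedGroup.toGroup (f := countedGen (by omega)) (by
    rw [lift_cycleRels hn]
    simp only [FreeGroup.lift_apply_of]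
    have hn0 : 0 < n := by omega
    refine ⟨fun i hi => ?_, ?_, fun i j hij hj hne => ?_⟩
    · rw [countedGen_cyclePt hn0 (by omega), countedGen_cyclePt hn0 hi]
      by_cases h : i + 2 = n
      · rw [show i + 1 + 1 = n by omega, cyclePt_self]
        exact countedSwap_braid (cyclePt_ne _ (by omega) (by omega) (by omega))
          (cyclePt_ne _ (by omega) (by omega) (by omega))
          (cyclePt_ne _ (by omega) (by omega) (by omega)) _ _
      · exact countedSwap_braid (cyclePt_ne _ (by omega) (by omega) (by omega))
          (cyclePt_ne _ (by omega) (by omega) (by omega))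
          (cyclePt_ne _ (by omega) (by omega) (by omega)) _ _
    · rw [countedGen_cyclePt hn0 (by omega), countedGen_cyclePt hn0 (by omega),
        show n - 1 + 1 = n by omega, cyclePt_self]
      exact (countedSwap_braid (cyclePt_ne _ (by omega) (by omega) (by omega))
          (cyclePt_ne _ (by omega) (by omega) (by omega))
          (cyclePt_ne _ (by omega) (by omega) (by omega)) _ _).symm
    · rw [countedGen_cyclePt hn0 (by omega), countedGen_cyclePt hn0 (by omega)]
      by_cases h : j + 1 = n
      · rw [h, cyclePt_self]
        exact countedSwap_comm (cyclePt_ne _ (by omega) (by omega) (by omega))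
          (cyclePt_ne _ (by omega) (by omega) (by omega))
          (cyclePt_ne _ (by omega) (by omega) (by omega))
          (cyclePt_ne _ (by omega) (by omega) (by omega)) _ _
      · exact countedSwap_comm (cyclePt_ne _ (by omega) (by omega) (by omega))
          (cyclePt_ne _ (by omega) (by omega) (by omega))
          (cyclePt_ne _ (by omega) (by omega) (by omega))
          (cyclePt_ne _ (by omega) (by omega) (by omega)) _ _)

/-- The generators of `A(Δ_n)`, indexed cyclically by the natural numbers. -/
def cycleGen {n : ℕ} (hn : 0 < n) (i : ℕ) : PresentedGroup (cycleRels n) :=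
  PresentedGroup.of (cyclePt hn i)

lemma countHom_cycleGen {n : ℕ} (hn : 2 < n) {i : ℕ} (hi : i < n) :
    countHom hn (cycleGen (by omega) i) = countedSwap (cyclePt (by omega) i)
      (cyclePt (by omega) (i + 1)) (if i + 1 = n then 1 else 0) := by
  rw [← countedGen_cyclePt _ hi]
  exact PresentedGroup.toGroup.of _

lemma countHom_right {n : ℕ} (hn : 2 < n) (σ : PresentedGroup (cycleRels n) →* Equiv.Perm (Fin n))
    (hσ : ∀ x : Fin n, σ (PresentedGroup.of x)
      = Equiv.swap x ⟨(x.val + 1) % n, Nat.mod_lt _ (by omega)⟩)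
    (g : PresentedGroup (cycleRels n)) : (countHom hn g).right = σ g := by
  have : SemidirectProduct.rightHom.comp (countHom hn) = σ := by
    apply PresentedGroup.ext
    intro x
    rw [hσ, MonoidHom.comp_apply, countHom, PresentedGroup.toGroup.of]
    rfl
  rw [← this]
  rfl

lemma cycleAction {n : ℕ} (hn : 2 < n) (σ : PresentedGroup (cycleRels n) →* Equiv.Perm (Fin n))
    (hσ : ∀ x : Fin n, σ (PresentedGroup.of x)
      = Equiv.swap x ⟨(x.val + 1) % n, Nat.mod_lt _ (by omega)⟩) :
    CycleAction n σ (cyclePt (by omega)) (cycleGen (n := n) (by omega)) where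
  pt_inj i j hi hj h := by
    by_contra hne
    exact cyclePt_ne _ hi hj hne h
  pt_surj x := ⟨x, x.2, by simp [cyclePt, Nat.mod_eq_of_lt x.2]⟩
  pt_wrap := cyclePt_self _
  map_gen i hi := by
    rw [cycleGen, hσ]
    simp [cyclePt]
  braid := ((lift_cycleRels hn (PresentedGroup.mk (cycleRels n))).1
    (fun w hw => PresentedGroup.one_of_mem hw)).1
  comm := ((lift_cycleRels hn (PresentedGroup.mk (cycleRels n))).1
    (fun w hw => PresentedGroup.one_of_mem hw)).2.2
  closure_gen := by
    rw [eq_top_iff, ← PresentedGroup.closure_range_of]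
    apply Subgroup.closure_mono
    rintro _ ⟨x, rfl⟩
    exact ⟨x, x.2, by simp [cycleGen, cyclePt, Nat.mod_eq_of_lt x.2]⟩

/-- The crossing and winding numbers of a set `x`, as a homomorphism on its stabiliser. -/
noncomputable def countStabilizer {n : ℕ} (hn : 2 < n)
    (σ : PresentedGroup (cycleRels n) →* Equiv.Perm (Fin n))
    (hσ : ∀ x : Fin n, σ (PresentedGroup.of x)
      = Equiv.swap x ⟨(x.val + 1) % n, Nat.mod_lt _ (by omega)⟩) (x : Set (Fin n)) :
    Subgroup.comap σ (MulAction.stabilizer (Equiv.Perm (Fin n)) x) →*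
      Multiplicative (Fin 4 → ℤ) where
  toFun g := (countHom hn g).left x
  map_one' := by simp
  map_mul' g h := by
    have hg : (σ g)⁻¹ • x = x := inv_smul_eq_iff.2 (MulAction.mem_stabilizer_iff.1 g.2).symm
    rw [Subgroup.coe_mul, map_mul, SemidirectProduct.mul_left, Pi.mul_apply, countHom_right hn σ hσ]
    congr 1
    change (countHom hn h).left ((σ g)⁻¹ • x) = _
    rw [hg]

end Cocycle

section Values

open scoped Pointwise

variable {n : ℕ} (hn : 2 < n)

lemma countHom_cycleGen_mul_left {i : ℕ} (hi : i < n) (g : PresentedGroup (cycleRels n))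
    (x : Set (Fin n)) :
    ((countHom hn (cycleGen (Nat.zero_lt_of_lt hn) i * g)).left x).toAdd =
      crossing (cyclePt (Nat.zero_lt_of_lt hn) i ∈ x) (cyclePt (Nat.zero_lt_of_lt hn) (i + 1) ∈ x)
        (if i + 1 = n then 1 else 0) +
      ((countHom hn g).left
        (Equiv.swap (cyclePt (Nat.zero_lt_of_lt hn) i) (cyclePt (Nat.zero_lt_of_lt hn) (i + 1)) • x)).toAdd := by
  rw [map_mul, countHom_cycleGen hn hi, countedSwap_mul_left]

lemma swap_smul_pair (p q r s : Fin n) :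
    Equiv.swap p q • ({r, s} : Set (Fin n)) = {Equiv.swap p q r, Equiv.swap p q s} := by
  simp [← Set.image_smul, Set.image_pair]

lemma countHom_ascend {k : ℕ} (hk : 1 + k < n) :
    ((countHom hn (ascend (cycleGen (by omega)) 1 k)).left
      {cyclePt (by omega) 0, cyclePt (by omega) (1 + k)}).toAdd = ![0, (k : ℤ), 0, 0] := by
  induction k with
  | zero => ext i; fin_cases i <;> simp [ascend]
  | succ k ih =>
    have h1 : cyclePt (n := n) (by omega) (1 + k) ≠ cyclePt (by omega) 0 :=
      cyclePt_ne _ (by omega) (by omega) (by omega)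
    have h2 : cyclePt (n := n) (by omega) (1 + k) ≠ cyclePt (by omega) (1 + k + 1) :=
      cyclePt_ne _ (by omega) (by omega) (by omega)
    have h3 : cyclePt (n := n) (by omega) 0 ≠ cyclePt (by omega) (1 + k + 1) :=
      cyclePt_ne _ (by omega) (by omega) (by omega)
    rw [ascend, countHom_cycleGen_mul_left hn (by omega), swap_smul_pair, ← add_assoc,
      Equiv.swap_apply_right, Equiv.swap_apply_of_ne_of_ne h1.symm h3, ih (by omega)]
    ext i
    fin_cases i <;> simp [crossing, h1, h2, show 1 + k + 1 ≠ n by omega, add_comm (1 : ℤ)]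

lemma countHom_gen_zero :
    ((countHom hn (cycleGen (by omega) 0)).left
      {cyclePt (by omega) 0, cyclePt (by omega) 1}).toAdd = ![1, 0, 0, 0] := by
  rw [countHom_cycleGen hn (by omega)]
  ext i
  fin_cases i <;> simp [countedSwap, crossing, show 1 ≠ n by omega]

lemma countHom_gen_one_sq :
    ((countHom hn (cycleGen (by omega) 1 ^ 2)).left
      {cyclePt (by omega) 0, cyclePt (by omega) 1}).toAdd = ![0, 2, 0, 0] := by
  have h1 : cyclePt (n := n) (by omega) 1 ≠ cyclePt (by omega) 0 :=
    cyclePt_ne _ (by omega) (by omega) (by omega)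
  have h2 : cyclePt (n := n) (by omega) 1 ≠ cyclePt (by omega) 2 :=
    cyclePt_ne _ (by omega) (by omega) (by omega)
  have h3 : cyclePt (n := n) (by omega) 0 ≠ cyclePt (by omega) 2 :=
    cyclePt_ne _ (by omega) (by omega) (by omega)
  rw [sq, countHom_cycleGen_mul_left hn (by omega), swap_smul_pair,
    Equiv.swap_apply_left, Equiv.swap_apply_of_ne_of_ne h1.symm h3,
    countHom_cycleGen hn (by omega)]
  ext i
  fin_cases i <;> simp [countedSwap, crossing, h1, h2, h2.symm, h3.symm, show 2 ≠ n by omega]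

lemma countHom_gen_two (hn5 : 5 ≤ n) :
    ((countHom hn (cycleGen (by omega) 2)).left
      {cyclePt (by omega) 0, cyclePt (by omega) 1}).toAdd = ![0, 0, 1, 0] := by
  have h : ∀ i j, i < n → j < n → i ≠ j → cyclePt (n := n) (by omega) i ≠ cyclePt (by omega) j :=
    fun i j => cyclePt_ne _
  rw [countHom_cycleGen hn (by omega)]
  ext i
  fin_cases i <;> simp [countedSwap, crossing, h 2 0 (by omega) (by omega), h 2 1 (by omega),
    h 3 0 (by omega) (by omega), h 3 1 (by omega), show 1 < n by omega, show 3 ≠ n by omega]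

lemma countHom_rotation {m : ℕ} (hm : m + 1 = n) :
    ((countHom hn (cycleGen (by omega) m * pairRep (cycleGen (by omega)) 1 m)).left
      {cyclePt (by omega) 0, cyclePt (by omega) 1}).toAdd = ![0, (n : ℤ), 0, -1] := by
  have h1 : cyclePt (n := n) (by omega) m ≠ cyclePt (by omega) 0 :=
    cyclePt_ne _ (by omega) (by omega) (by omega)
  have h2 : cyclePt (n := n) (by omega) m ≠ cyclePt (by omega) 1 :=
    cyclePt_ne _ (by omega) (by omega) (by omega)
  have h3 : cyclePt (n := n) (by omega) 0 ≠ cyclePt (by omega) 1 :=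
    cyclePt_ne _ (by omega) (by omega) (by omega)
  have ha : pairRep (cycleGen (n := n) (by omega)) 1 m =
      cycleGen (by omega) 0 * ascend (cycleGen (by omega)) 1 (m - 1) := by
    simp [pairRep, ascend]
  have hasc := countHom_ascend hn (k := m - 1) (by omega)
  rw [show 1 + (m - 1) = m by omega] at hasc
  rw [ha, countHom_cycleGen_mul_left hn (by omega), hm, cyclePt_self, swap_smul_pair,
    Equiv.swap_apply_right, Equiv.swap_apply_of_ne_of_ne h2.symm h3.symm,
    countHom_cycleGen_mul_left hn (by omega), zero_add, swap_smul_pair,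
    Equiv.swap_apply_right, Equiv.swap_apply_of_ne_of_ne h1 h2, Set.pair_comm (cyclePt _ m) (cyclePt _ 0), hasc]
  have hmn : ((m - 1 : ℕ) : ℤ) = n - 2 := by omega
  rw [hmn]
  ext i
  fin_cases i <;> simp [crossing, h1, h2, h1.symm, h2.symm, h3, show 1 ≠ n by omega]
  ring

lemma mem_comap_stabilizer_pair {G : Type*} [Group G] (σ : G →* Equiv.Perm (Fin n))
    (p q : Fin n) (g : G) :
    g ∈ Subgroup.comap σ (MulAction.stabilizer (Equiv.Perm (Fin n)) ({p, q} : Set (Fin n))) ↔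
      (s(p, q)).map (σ g) = s(p, q) := by
  rw [Subgroup.mem_comap, MulAction.mem_stabilizer_iff, ← Set.image_smul, Set.image_pair,
    Set.pair_eq_pair_iff, Sym2.map_mk, Sym2.eq_iff]
  rfl

end Values

open Pointwise in
/-- The abelianisation of the stabiliser, for the pair written in terms of `cyclePt`. -/
theorem abelianization_stabilizer_pair {n : ℕ} (hn : 5 ≤ n)
    (σ : PresentedGroup (cycleRels n) →* Equiv.Perm (Fin n))
    (hσ : ∀ x : Fin n, σ (PresentedGroup.of x)
      = Equiv.swap x ⟨(x.val + 1) % n, Nat.mod_lt _ (by omega)⟩) :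
    Nonempty (Additive (Abelianization
      (Subgroup.comap σ (MulAction.stabilizer (Equiv.Perm (Fin n))
        ({cyclePt (by omega) 0, cyclePt (by omega) 1} : Set (Fin n))))) ≃+ (Fin 4 → ℤ)) := by
  have hn2 : 2 < n := by omega
  have A := cycleAction hn2 σ hσ
  set a : ℕ → PresentedGroup (cycleRels n) := cycleGen (by omega) with ha
  set pt : ℕ → Fin n := cyclePt (by omega) with hpt
  set H := Subgroup.comap σ (MulAction.stabilizer (Equiv.Perm (Fin n))
    ({pt 0, pt 1} : Set (Fin n))) with hH
  have memH : ∀ g, g ∈ H ↔ (s(pt 0, pt 1)).map (σ g) = s(pt 0, pt 1) :=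
    mem_comap_stabilizer_pair σ _ _
  obtain ⟨m, hm⟩ : ∃ m, m + 1 = n := ⟨n - 1, by omega⟩
  have g00 := A.gen_left (i := 0) (by omega)
  have g01 := A.gen_right (i := 0) (by omega)
  have g11 := A.gen_left (i := 1) (by omega)
  have g12 := A.gen_right (i := 1) (by omega)
  have g10 := A.gen_of_ne (i := 1) (j := 0) (by omega) (by omega) (by omega) (by omega)
  have g20 := A.gen_of_ne (i := 2) (j := 0) (by omega) (by omega) (by omega) (by omega)
  have g21 := A.gen_of_ne (i := 2) (j := 1) (by omega) (by omega) (by omega) (by omega)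
  have gm := A.gen_left (i := m) (by omega)
  have gm1 := A.gen_last_of_ne (i := m) (j := 1) hm (by omega) (by omega) (by omega)
  rw [zero_add] at g00 g01
  rw [hm, A.pt_wrap] at gm
  have m0 : a 0 ∈ H := by
    rw [memH, Sym2.map_mk, g00, g01, Sym2.eq_swap]
  have m1 : a 1 ^ 2 ∈ H := by
    rw [memH, sq, LoopIn.map_mul, Sym2.map_mk, g10, g11, Sym2.map_mk, g10, g12]
  have m2 : a 2 ∈ H := by
    rw [memH, Sym2.map_mk, g20, g21]
  have m3 : a m * pairRep a 1 m ∈ H := by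
    rw [memH, LoopIn.map_mul, A.pairRep_map (by omega) (by omega), Sym2.map_mk, gm, gm1,
      Sym2.eq_swap]
  let E : Fin 4 → Additive (Abelianization H) := ![
    Additive.ofMul (Abelianization.of ⟨_, m0⟩), Additive.ofMul (Abelianization.of ⟨_, m1⟩),
    Additive.ofMul (Abelianization.of ⟨_, m2⟩), Additive.ofMul (Abelianization.of ⟨_, m3⟩)]
  let f := Fintype.linearCombination ℤ E
  have hEf : ∀ i, E i ∈ f.range.toAddSubgroup := fun i => ⟨Pi.single i 1, by simp [f]⟩
  let χ : Additive (Abelianization H) →+ (Fin 4 → ℤ) :=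
    MonoidHom.toAdditiveLeft (Abelianization.lift (countStabilizer hn2 σ hσ {pt 0, pt 1}))
  have χ0 : χ (E 0) = ![1, 0, 0, 0] := countHom_gen_zero hn2
  have χ1 : χ (E 1) = ![0, 2, 0, 0] := countHom_gen_one_sq hn2
  have χ2 : χ (E 2) = ![0, 0, 1, 0] := countHom_gen_two hn2 hn
  have χ3 : χ (E 3) = ![0, (n : ℤ), 0, -1] := countHom_rotation hn2 hm
  have inj : Function.Injective f := by
    rw [injective_iff_map_eq_zero]
    intro v hv
    have h : χ (f v) = 0 := by rw [hv, map_zero]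
    rw [Fintype.linearCombination_apply, map_sum, Fin.sum_univ_four, map_zsmul, map_zsmul,
      map_zsmul, map_zsmul, χ0, χ1, χ2, χ3] at h
    have c0 := congrFun h 0
    have c1 := congrFun h 1
    have c2 := congrFun h 2
    have c3 := congrFun h 3
    simp at c0 c1 c2 c3
    ext i
    fin_cases i
    · exact c0
    · simpa [c3] using c1
    · exact c2
    · exact c3
  have surj : Function.Surjective f := by
    let K : Subgroup (PresentedGroup (cycleRels n)) :=
      ((AddSubgroup.toSubgroup' f.range.toAddSubgroup).comap Abelianization.of).map H.subtype
    have memK : ∀ {g} (hg : g ∈ H), g ∈ K ↔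
        Additive.ofMul (Abelianization.of (⟨g, hg⟩ : H)) ∈ f.range.toAddSubgroup := by
      intro g hg
      constructor
      · rintro ⟨y, hy, rfl⟩
        exact hy
      · exact fun h => ⟨⟨g, hg⟩, h, rfl⟩
    have KH : K ≤ H := Subgroup.map_subtype_le _
    have hK : ∀ h k, (s(pt 0, pt 1)).map (σ h) = s(pt 0, pt 1) → k ∈ K → h * k * h⁻¹ ∈ K := by
      intro h k hh hk
      have hhH := (memH h).2 hh
      have hkH := KH hk
      rw [memK (H.mul_mem (H.mul_mem hhH hkH) (H.inv_mem hhH))]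
      have e : Abelianization.of (⟨h * k * h⁻¹, H.mul_mem (H.mul_mem hhH hkH) (H.inv_mem hhH)⟩ : H)
          = Abelianization.of ⟨k, hkH⟩ := by
        change Abelianization.of ((⟨h, hhH⟩ : H) * ⟨k, hkH⟩ * (⟨h, hhH⟩ : H)⁻¹) = _
        rw [map_mul, map_mul, map_inv, mul_inv_cancel_comm]
      rw [e]
      exact (memK hkH).1 hk
    intro y
    obtain ⟨⟨g, hg⟩, rfl⟩ : ∃ g : H, Additive.ofMul (Abelianization.of g) = y :=
      QuotientGroup.mk_surjective y.toMul
    exact (memK hg).1 (A.mem_of_map_eq hn hK ((memK m0).2 (hEf 0)) ((memK m1).2 (hEf 1))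
      ((memK m2).2 (hEf 2)) hm ((memK m3).2 (hEf 3)) ((memH g).1 hg)
      fun k hk => (memH k).1 (KH hk))
  exact ⟨(AddEquiv.ofBijective f.toAddMonoidHom ⟨inj, surj⟩).symm⟩

open Pointwise in
/-- part of Proposition 4.2: for `n > 4`, with
`σ : A(Δ_n) → Sym(n)` the homomorphism `a_i ↦ (i,i+1)`, `a_n ↦ (1,n)`, and `H` the
preimage under `σ` of the setwise stabiliser of `{1, 2}` (i.e. `{0, 1}` in our
`Fin n` indexing), the abelianisation of `H` is free abelian of rank `4`. -/
theorem abelianization_H (n : ℕ) (hn : 4 < n)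
    (σ : PresentedGroup (cycleRels n) →* Equiv.Perm (Fin n))
    (hσ : ∀ x : Fin n, σ (PresentedGroup.of x)
      = Equiv.swap x ⟨(x.val + 1) % n, Nat.mod_lt _ (by omega)⟩) :
    Nonempty (Additive (Abelianization
      (Subgroup.comap σ (MulAction.stabilizer (Equiv.Perm (Fin n))
        ({⟨0, by omega⟩, ⟨1, by omega⟩} : Set (Fin n))))) ≃+ (Fin 4 → ℤ)) := by
  have h0 : (⟨0, by omega⟩ : Fin n) = cyclePt (by omega) 0 := by simp [cyclePt]
  have h1 : (⟨1, by omega⟩ : Fin n) = cyclePt (by omega) 1 := by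
    simp [cyclePt, Nat.mod_eq_of_lt (show 1 < n by omega)]
  rw [h0, h1]
  exact abelianization_stabilizer_pair hn σ hσ

end ArtinPaper
end
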